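/- arXiv:2411.18955 — 3 statements merged into one kernel-verified Lean document; each statement's English description precedes it below -/
import Mathlib

section
/- Let V be a finite vertex set and a, b ∈ V. The map π^{[a,b]}: Λ_n^{[a,b]}(V) → Λ̃_{n-2}(V) defined by e_{a i_0…i_{n-2} b} ↦ e_{i_0…i_{n-2}} for n ≥ 2, e_{ab} ↦ 1 ∈ R for n = 1, intertwines the cluster differential d with the augmented differential ∂, i.e., the square π∘d = ∂∘π commutes. Consequently (Λ_*^{[a,b]}(V), d) is a chain complex (d∘d = 0). -/
noncomputable section

namespace PrimitivePath

/-- A simple digraph: arrows between distinct vertices. -/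
structure SDigraph (V : Type) where
  Adj : V → V → Prop
  loopless : ∀ v, ¬ Adj v v

section

variable (R V : Type) [CommRing R] [DecidableEq V]

/-- `Chain R V n` is the free `R`-module `Λ_n(V,R)` on elementary `n`-paths
(sequences of `n+1` vertices). -/
abbrev Chain (n : ℕ) : Type _ := (Fin (n + 1) → V) →₀ R

/-- An elementary path is allowed if consecutive vertices are joined by arrows. -/
def IsAllowed {V : Type} (G : SDigraph V) {n : ℕ} (p : Fin (n + 1) → V) : Prop :=
  ∀ i : Fin n, G.Adj (p i.castSucc) (p i.succ)

/-- An elementary path is regular if it has no two equal consecutive vertices. -/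
def IsRegular {V : Type} {n : ℕ} (p : Fin (n + 1) → V) : Prop :=
  ∀ i : Fin n, p i.castSucc ≠ p i.succ

instance {n : ℕ} (p : Fin (n + 1) → V) : Decidable (IsRegular p) :=
  inferInstanceAs (Decidable (∀ i : Fin n, p i.castSucc ≠ p i.succ))

/-- The differential `∂ : Λ_{n+1} → Λ_n`, alternating sum of vertex deletions. -/
def boundary (n : ℕ) : Chain R V (n + 1) →ₗ[R] Chain R V n :=
  Finsupp.lsum R fun p => ∑ m : Fin (n + 2),
    ((-1 : R) ^ (m : ℕ)) • Finsupp.lsingle (fun i : Fin (n + 1) => p (m.succAbove i))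

/-- The `m`-th face map `∂^m : Λ_{n+1} → Λ_n`, deleting the `m`-th vertex. -/
def faceMap (n : ℕ) (m : Fin (n + 2)) : Chain R V (n + 1) →ₗ[R] Chain R V n :=
  Finsupp.lsum R fun p => Finsupp.lsingle (fun i : Fin (n + 1) => p (m.succAbove i))

/-- The submodule of chains all of whose elementary paths satisfy `P`. -/
def pathsWith {n : ℕ} (P : (Fin (n + 1) → V) → Prop) : Submodule R (Chain R V n) where
  carrier := {w | ∀ p ∈ w.support, P p}
  add_mem' := by
    intro x y hx hy p hp
    rcases Finset.mem_union.1 (Finsupp.support_add hp) with h | h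
    · exact hx p h
    · exact hy p h
  zero_mem' := by intro p hp; simp at hp
  smul_mem' := by intro c x hx p hp; exact hx p (Finsupp.support_smul hp)

/-- `A_n(G)`: the submodule of allowed chains. -/
def allowedChains (G : SDigraph V) (n : ℕ) : Submodule R (Chain R V n) :=
  pathsWith R V (fun p => IsAllowed G p)

/-- Chains all of whose elementary paths have tail vertex `a`. -/
def tailSet (a : V) (n : ℕ) : Submodule R (Chain R V n) :=
  pathsWith R V (fun p => p 0 = a)

/-- Chains all of whose elementary paths have head vertex `b`. -/
def headSet (b : V) (n : ℕ) : Submodule R (Chain R V n) :=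
  pathsWith R V (fun p => p (Fin.last n) = b)

/-- Chains all of whose elementary paths have tail `a` and head `b`
(the `(a,b)`-cluster module `Λ_n^{[a,b]}`). -/
def clusterSet (a b : V) (n : ℕ) : Submodule R (Chain R V n) :=
  pathsWith R V (fun p => p 0 = a ∧ p (Fin.last n) = b)

/-- Projection killing the irregular elementary paths, modelling `Λ_n → R_n = Λ_n/I_n`. -/
def regProj (n : ℕ) : Chain R V n →ₗ[R] Chain R V n :=
  Finsupp.lsum R fun p => if IsRegular p then Finsupp.lsingle p else 0

/-- The `(a,b)`-cluster component `w ↦ w^{[a,b]}`. -/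
def clusterComp (a b : V) (n : ℕ) : Chain R V n →ₗ[R] Chain R V n :=
  Finsupp.lsum R fun p =>
    if p 0 = a ∧ p (Fin.last n) = b then Finsupp.lsingle p else 0

/-- The `a`-tail component `w ↦ w^{[a,·]}`. -/
def tailComp (a : V) (n : ℕ) : Chain R V n →ₗ[R] Chain R V n :=
  Finsupp.lsum R fun p => if p 0 = a then Finsupp.lsingle p else 0

/-- The `b`-head component `w ↦ w^{[·,b]}`. -/
def headComp (b : V) (n : ℕ) : Chain R V n →ₗ[R] Chain R V n :=
  Finsupp.lsum R fun p => if p (Fin.last n) = b then Finsupp.lsingle p else 0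

/-- `Π_n(G)`: the primitive path chain modules. -/
def piChains (G : SDigraph V) : (n : ℕ) → Submodule R (Chain R V n)
  | 0 => allowedChains R V G 0
  | n + 1 =>
      allowedChains R V G (n + 1) ⊓ (allowedChains R V G n).comap (boundary R V n)

/-- `Ω_n(G)`: the path chain modules (differential taken modulo irregular paths). -/
def omegaChains (G : SDigraph V) : (n : ℕ) → Submodule R (Chain R V n)
  | 0 => allowedChains R V G 0
  | n + 1 =>
      allowedChains R V G (n + 1) ⊓
        (allowedChains R V G n).comap ((regProj R V n).comp (boundary R V n))

/-- Cycles of the primitive path chain complex. -/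
def piCycles (G : SDigraph V) : (n : ℕ) → Submodule R (Chain R V n)
  | 0 => piChains R V G 0
  | n + 1 => piChains R V G (n + 1) ⊓ LinearMap.ker (boundary R V n)

/-- Boundaries of the primitive path chain complex. -/
def piBoundaries (G : SDigraph V) (n : ℕ) : Submodule R (Chain R V n) :=
  (piChains R V G (n + 1)).map (boundary R V n)

/-- Primitive path homology `H_n(Π_*(G))`: the image of the cycles in the
quotient by the boundaries. -/
abbrev piHomology (G : SDigraph V) (n : ℕ) : Type _ :=
  ↥((piCycles R V G n).map (piBoundaries R V G n).mkQ)

/-- Cycles of the path chain complex `Ω_*`. -/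
def omegaCycles (G : SDigraph V) : (n : ℕ) → Submodule R (Chain R V n)
  | 0 => omegaChains R V G 0
  | n + 1 => omegaChains R V G (n + 1) ⊓ LinearMap.ker ((regProj R V n).comp (boundary R V n))

/-- Boundaries of the path chain complex `Ω_*`. -/
def omegaBoundaries (G : SDigraph V) (n : ℕ) : Submodule R (Chain R V n) :=
  (omegaChains R V G (n + 1)).map ((regProj R V n).comp (boundary R V n))

/-- Path homology `H_n(Ω_*(G))`. -/
abbrev omegaHomology (G : SDigraph V) (n : ℕ) : Type _ :=
  ↥((omegaCycles R V G n).map (omegaBoundaries R V G n).mkQ)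

/-- The cluster differential `d : Λ_{n+2}^{[a,b]} → Λ_{n+1}^{[a,b]}`
(alternating deletion of interior vertices only). -/
def clusterBoundary (n : ℕ) : Chain R V (n + 2) →ₗ[R] Chain R V (n + 1) :=
  Finsupp.lsum R fun p => ∑ m : Fin (n + 1),
    ((-1 : R) ^ (m : ℕ)) •
      Finsupp.lsingle (fun i : Fin (n + 2) => p (m.succ.castSucc.succAbove i))

/-- `π^{[a,b]}` in degrees `≥ 2`: delete the two end vertices. -/
def stripEnds (n : ℕ) : Chain R V (n + 2) →ₗ[R] Chain R V n :=
  Finsupp.lsum R fun p => Finsupp.lsingle (fun i : Fin (n + 1) => p i.succ.castSucc)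

/-- The sum-of-coefficients map (augmentation when `n = 0`). -/
def totalCoeff (n : ℕ) : Chain R V n →ₗ[R] R :=
  Finsupp.lsum R fun _ => LinearMap.id

/-- `A_n^{[a,b]}(G)`: allowed `(a,b)`-cluster chains. -/
def allowedCluster (G : SDigraph V) (a b : V) (n : ℕ) : Submodule R (Chain R V n) :=
  allowedChains R V G n ⊓ clusterSet R V a b n

/-- `Θ_n^{[a,b]}(G)`. -/
def thetaChains (G : SDigraph V) (a b : V) : (n : ℕ) → Submodule R (Chain R V n)
  | 0 => ⊥
  | 1 => allowedCluster R V G a b 1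
  | n + 2 =>
      allowedCluster R V G a b (n + 2) ⊓
        (allowedCluster R V G a b (n + 1)).comap (clusterBoundary R V n)

def thetaCycles (G : SDigraph V) (a b : V) : (n : ℕ) → Submodule R (Chain R V n)
  | 0 => ⊥
  | 1 => thetaChains R V G a b 1
  | n + 2 => thetaChains R V G a b (n + 2) ⊓ LinearMap.ker (clusterBoundary R V n)

def thetaBoundaries (G : SDigraph V) (a b : V) : (n : ℕ) → Submodule R (Chain R V n)
  | 0 => ⊥
  | n + 1 => (thetaChains R V G a b (n + 2)).map (clusterBoundary R V n)

/-- Primitive `(a,b)`-cluster homology `H_n^{[a,b]}(G)`. -/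
abbrev thetaHomology (G : SDigraph V) (a b : V) (n : ℕ) : Type _ :=
  ↥((thetaCycles R V G a b n).map (thetaBoundaries R V G a b n).mkQ)

/-- The tail differential `d^t` (never deleting the tail vertex). -/
def tailBoundary (n : ℕ) : Chain R V (n + 1) →ₗ[R] Chain R V n :=
  Finsupp.lsum R fun p => ∑ m : Fin (n + 1),
    ((-1 : R) ^ (m : ℕ)) • Finsupp.lsingle (fun i : Fin (n + 1) => p (m.succ.succAbove i))

/-- The head differential `d^h` (never deleting the head vertex). -/
def headBoundary (n : ℕ) : Chain R V (n + 1) →ₗ[R] Chain R V n :=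
  Finsupp.lsum R fun p => ∑ m : Fin (n + 1),
    ((-1 : R) ^ (m : ℕ)) • Finsupp.lsingle (fun i : Fin (n + 1) => p (m.castSucc.succAbove i))

/-- `π^{[a,·]}` in degrees `≥ 1`: delete the first vertex. -/
def stripHead (n : ℕ) : Chain R V (n + 1) →ₗ[R] Chain R V n :=
  Finsupp.lsum R fun p => Finsupp.lsingle (fun i : Fin (n + 1) => p i.succ)

/-- `π^{[·,a]}` in degrees `≥ 1`: delete the last vertex. -/
def stripLast (n : ℕ) : Chain R V (n + 1) →ₗ[R] Chain R V n :=
  Finsupp.lsum R fun p => Finsupp.lsingle (fun i : Fin (n + 1) => p i.castSucc)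

/-- `A_n^{[a,·]}(G)`: allowed chains with tail `a`. -/
def allowedTail (G : SDigraph V) (a : V) (n : ℕ) : Submodule R (Chain R V n) :=
  allowedChains R V G n ⊓ tailSet R V a n

/-- `A_n^{[·,a]}(G)`: allowed chains with head `a`. -/
def allowedHead (G : SDigraph V) (a : V) (n : ℕ) : Submodule R (Chain R V n) :=
  allowedChains R V G n ⊓ headSet R V a n

/-- `Θ_n^{[a,·]}(G)`. -/
def tailTheta (G : SDigraph V) (a : V) : (n : ℕ) → Submodule R (Chain R V n)
  | 0 => allowedTail R V G a 0
  | n + 1 =>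
      allowedTail R V G a (n + 1) ⊓ (allowedTail R V G a n).comap (tailBoundary R V n)

/-- `Θ_n^{[·,a]}(G)`. -/
def headTheta (G : SDigraph V) (a : V) : (n : ℕ) → Submodule R (Chain R V n)
  | 0 => allowedHead R V G a 0
  | n + 1 =>
      allowedHead R V G a (n + 1) ⊓ (allowedHead R V G a n).comap (headBoundary R V n)

def tailCycles (G : SDigraph V) (a : V) : (n : ℕ) → Submodule R (Chain R V n)
  | 0 => tailTheta R V G a 0
  | n + 1 => tailTheta R V G a (n + 1) ⊓ LinearMap.ker (tailBoundary R V n)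

def tailBoundaries (G : SDigraph V) (a : V) (n : ℕ) : Submodule R (Chain R V n) :=
  (tailTheta R V G a (n + 1)).map (tailBoundary R V n)

/-- Primitive `a`-tail homology `H_n^{[a,·]}(G)`. -/
abbrev tailHomology (G : SDigraph V) (a : V) (n : ℕ) : Type _ :=
  ↥((tailCycles R V G a n).map (tailBoundaries R V G a n).mkQ)

/-- The path-reversal map with sign `(-1)^{n(n+1)/2}`. -/
def revMap (n : ℕ) : Chain R V n →ₗ[R] Chain R V n :=
  Finsupp.lsum R fun p =>
    ((-1 : R) ^ (n * (n + 1) / 2)) • Finsupp.lsingle (fun i : Fin (n + 1) => p i.rev)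

end

/-- The inverse directed digraph: all arrows reversed. -/
def SDigraph.reverse {V : Type} (G : SDigraph V) : SDigraph V where
  Adj v w := G.Adj w v
  loopless v h := G.loopless v h

section

variable (R : Type) [CommRing R] (V W : Type) [DecidableEq V] [DecidableEq W]

/-- The chain map `f_♯` induced by a vertex map: elementary paths go to their image
when regular, and to `0` otherwise. -/
def chainMap (f : V → W) (n : ℕ) : Chain R V n →ₗ[R] Chain R W n :=
  Finsupp.lsum R fun p =>
    if IsRegular (fun i => f (p i)) then Finsupp.lsingle (fun i => f (p i)) else 0

end

/-- A digraph is asymmetric if it has no symmetric pair of arrows. -/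
def SDigraph.Asymmetric {V : Type} (G : SDigraph V) : Prop :=
  ∀ v w, G.Adj v w → ¬ G.Adj w v


theorem face_swap_aux (n : ℕ) (m : Fin (n + 2)) (j : Fin (n + 1)) (i : Fin (n + 2)) :
    (m.succAbove j).succ.castSucc.succAbove ((j.predAbove m).succ.castSucc.succAbove i) =
      m.succ.castSucc.succAbove (j.succ.castSucc.succAbove i) := by
  have h := Fin.succAbove_succAbove_succAbove_predAbove m.succ.castSucc j.succ.castSucc i
  rw [← h]
  simp

theorem face_sign_aux (n : ℕ) (m : Fin (n + 2)) (j : Fin (n + 1)) :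
    ((m.succAbove j : Fin (n + 2)) : ℕ) + (j.predAbove m : Fin (n + 1)) + 1 = m + j ∨
    ((m.succAbove j : Fin (n + 2)) : ℕ) + (j.predAbove m : Fin (n + 1)) = m + j + 1 := by
  simp only [Fin.succAbove, Fin.predAbove, Fin.lt_def]
  split_ifs <;> simp at * <;> omega

theorem clusterBoundary_single (R V : Type) [CommRing R] [DecidableEq V] (n : ℕ)
    (p : Fin (n + 3) → V) (r : R) :
    clusterBoundary R V n (Finsupp.single p r) = ∑ m : Fin (n + 1),
      ((-1 : R) ^ (m : ℕ)) •
        Finsupp.single (fun i : Fin (n + 2) => p (m.succ.castSucc.succAbove i)) r := by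
  simp [clusterBoundary]

theorem clusterBoundary_sq (R V : Type) [CommRing R] [DecidableEq V] (k : ℕ) :
    (clusterBoundary R V k).comp (clusterBoundary R V (k + 1)) = 0 := by
  refine Finsupp.lhom_ext fun p r => ?_
  rw [LinearMap.comp_apply, clusterBoundary_single, map_sum]
  simp only [map_smul, clusterBoundary_single, Finset.smul_sum, smul_smul, ← pow_add,
    LinearMap.zero_apply]
  rw [← Finset.sum_product', Finset.univ_product_univ]
  refine Finset.sum_involution
    (fun (x : Fin (k + 2) × Fin (k + 1)) _ => (x.1.succAbove x.2, x.2.predAbove x.1)) ?_ ?_ ?_ ?_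
  · rintro ⟨m, j⟩ -
    simp only [face_swap_aux]
    rw [← add_smul]
    convert zero_smul R _
    rcases face_sign_aux k m j with h | h
    · rw [← h, pow_succ]; ring
    · rw [h, pow_succ]; ring
  · rintro ⟨m, j⟩ - - h
    exact Fin.succAbove_ne m j (congrArg Prod.fst h)
  · intros; exact Finset.mem_univ _
  · rintro ⟨m, j⟩ -
    exact Prod.ext (Fin.succAbove_succAbove_predAbove m j) (Fin.predAbove_predAbove_succAbove m j)

theorem stripEnds_single (R V : Type) [CommRing R] [DecidableEq V] (n : ℕ)
    (p : Fin (n + 3) → V) (r : R) :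
    stripEnds R V n (Finsupp.single p r) =
      Finsupp.single (fun i : Fin (n + 1) => p i.succ.castSucc) r := by
  simp [stripEnds]

theorem boundary_single (R V : Type) [CommRing R] [DecidableEq V] (n : ℕ)
    (p : Fin (n + 2) → V) (r : R) :
    boundary R V n (Finsupp.single p r) = ∑ m : Fin (n + 2),
      ((-1 : R) ^ (m : ℕ)) •
        Finsupp.single (fun i : Fin (n + 1) => p (m.succAbove i)) r := by
  simp [boundary]

theorem stripEnds_comm (R V : Type) [CommRing R] [DecidableEq V] (k : ℕ) :
    (stripEnds R V k).comp (clusterBoundary R V (k + 1)) =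
      (boundary R V k).comp (stripEnds R V (k + 1)) := by
  refine Finsupp.lhom_ext fun p r => ?_
  rw [LinearMap.comp_apply, clusterBoundary_single, map_sum]
  rw [LinearMap.comp_apply, stripEnds_single, boundary_single]
  refine Finset.sum_congr rfl fun m _ => ?_
  rw [map_smul, stripEnds_single]
  congr 2
  funext i
  rw [Fin.castSucc_succAbove_castSucc, Fin.succ_succAbove_succ]

theorem totalCoeff_comm (R V : Type) [CommRing R] [DecidableEq V] :
    (totalCoeff R V 1).comp (clusterBoundary R V 0) =
      (totalCoeff R V 0).comp (stripEnds R V 0) := by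
  refine Finsupp.lhom_ext fun p r => ?_
  rw [LinearMap.comp_apply, clusterBoundary_single, map_sum]
  simp [stripEnds, totalCoeff]

/-- Proposition 5.2, Corollary 5.3: deleting the two end vertices
intertwines the cluster differential `d` with the (augmented) differential `∂`, and
consequently `d ∘ d = 0` on cluster paths. -/
theorem cluster_differential_intertwines
    (R : Type) [CommRing R] (V : Type) [DecidableEq V] [Fintype V] (a b : V) :
    (∀ (k : ℕ) (w : Chain R V (k + 3)), w ∈ clusterSet R V a b (k + 3) →
      stripEnds R V k (clusterBoundary R V (k + 1) w) =
        boundary R V k (stripEnds R V (k + 1) w)) ∧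
    (∀ w : Chain R V 2, w ∈ clusterSet R V a b 2 →
      totalCoeff R V 1 (clusterBoundary R V 0 w) =
        totalCoeff R V 0 (stripEnds R V 0 w)) ∧
    (∀ (k : ℕ) (w : Chain R V (k + 3)), w ∈ clusterSet R V a b (k + 3) →
      clusterBoundary R V k (clusterBoundary R V (k + 1) w) = 0) := by
  exact ⟨fun k w _ => LinearMap.congr_fun (stripEnds_comm R V k) w,
    fun w _ => LinearMap.congr_fun (totalCoeff_comm R V) w,
    fun k w _ => LinearMap.congr_fun (clusterBoundary_sq R V k) w⟩

end PrimitivePath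

end
end

section
/- Let G = (V,E) be a digraph and a, b ∈ V with (a→b) ∉ E. Then the restriction of π^{[a,b]} (deleting the endpoints a and b) defines a morphism of chain complexes Θ_n^{[a,b]}(G) → Π_{n-2}(G), and hence induces homomorphisms H_n^{[a,b]}(G) → H_{n-2}(G) from primitive (a,b)-cluster homology to primitive path homology. -/
noncomputable section

namespace PrimitivePath

theorem stripEnds_mem_allowed (R : Type) [CommRing R] (V : Type) [DecidableEq V]
    (G : SDigraph V) (k : ℕ) (w : Chain R V (k + 2))
    (hw : w ∈ allowedChains R V G (k + 2)) :
    stripEnds R V k w ∈ allowedChains R V G k := by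
  unfold stripEnds
  rw [Finsupp.lsum_apply]
  refine Submodule.sum_mem _ fun p hp => ?_
  intro q hq
  have hq' : q = fun i : Fin (k + 1) => p i.succ.castSucc := by
    have := Finsupp.support_single_subset hq
    simpa using this
  subst hq'
  intro i
  have := hw p hp i.castSucc.succ
  exact this

theorem stripEnds_clusterBoundary (R : Type) [CommRing R] (V : Type) [DecidableEq V]
    (k : ℕ) (w : Chain R V (k + 3)) :
    stripEnds R V k (clusterBoundary R V (k + 1) w) =
      boundary R V k (stripEnds R V (k + 1) w) := by
  have h : (stripEnds R V k).comp (clusterBoundary R V (k + 1)) =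
      (boundary R V k).comp (stripEnds R V (k + 1)) := by
    ext1 p
    ext1
    simp only [stripEnds, clusterBoundary, boundary, LinearMap.comp_apply,
      Finsupp.lsingle_apply, Finsupp.lsum_single, LinearMap.sum_apply, LinearMap.smul_apply,
      map_sum, map_smul]
    refine Finset.sum_congr rfl fun m _ => ?_
    congr 2
    funext i
    rw [Fin.castSucc_succAbove_castSucc, Fin.succ_succAbove_succ]
  exact LinearMap.congr_fun h w

/-- Theorem 5.8(i): if `(a → b) ∉ E`, the map `π^{[a,b]}` deleting the
end vertices is a morphism of chain complexes `Θ_*^{[a,b]}(G) → Π_{*-2}(G)`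
(in particular `Θ_1^{[a,b]}(G) = 0`). -/
theorem theta_to_pi_morphism_of_not_adj
    (R : Type) [CommRing R] (V : Type) [DecidableEq V] [Fintype V]
    (G : SDigraph V) (a b : V) (hab : ¬ G.Adj a b) :
    thetaChains R V G a b 1 = ⊥ ∧
    (∀ k : ℕ, (thetaChains R V G a b (k + 2)).map (stripEnds R V k) ≤
      piChains R V G k) ∧
    (∀ k : ℕ, ∀ w ∈ thetaChains R V G a b (k + 3),
      stripEnds R V k (clusterBoundary R V (k + 1) w) =
        boundary R V k (stripEnds R V (k + 1) w)) := by
  refine ⟨?_, ?_, fun k w _ => stripEnds_clusterBoundary R V k w⟩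
  · rw [eq_bot_iff]
    rintro w ⟨hw, hc⟩
    rw [Submodule.mem_bot, ← Finsupp.support_eq_empty, Finset.eq_empty_iff_forall_notMem]
    intro p hp
    have h1 := hw p hp 0
    obtain ⟨h2, h3⟩ := hc p hp
    apply hab
    rw [← h2, ← h3]
    exact h1
  · rintro k _ ⟨w, hw, rfl⟩
    cases k with
    | zero => exact stripEnds_mem_allowed R V G 0 w hw.1.1
    | succ k =>
      refine ⟨stripEnds_mem_allowed R V G (k + 1) w hw.1.1, ?_⟩
      change boundary R V k (stripEnds R V (k + 1) w) ∈ allowedChains R V G k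
      rw [← stripEnds_clusterBoundary]
      exact stripEnds_mem_allowed R V G k _ hw.2.1

end PrimitivePath

end
end

section
/- Let G = (V,E) be a digraph and CG its cone, obtained by adding a new vertex a with an arrow v→a for each v ∈ V. Then for every vertex v ∈ V and every n, the primitive (v,a)-cluster homology of CG is isomorphic to the primitive v-tail homology of G shifted by one: H_n^{[v,a]}(CG) ≅ H_{n-1}^{[v,·]}(G). -/
noncomputable section

namespace PrimitivePath

/-- The cone `CG`: a new vertex `a = none` with an arrow `v → a` for every vertex `v`. -/
def coneD {V : Type} (G : SDigraph V) : SDigraph (Option V) where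
  Adj x y :=
    match x, y with
    | some v, some w => G.Adj v w
    | some _, none => True
    | _, _ => False
  loopless := by
    rintro (_ | v) h
    · exact h
    · exact G.loopless v h

section ConeProof

/-- Append the apex to a path of `G`. -/
def conePath {V : Type} {n : ℕ} (p : Fin (n + 1) → V) : Fin (n + 1 + 1) → Option V :=
  fun i => Fin.lastCases (motive := fun _ => Option V) none (fun j => some (p j)) i

lemma conePath_last {V : Type} {n : ℕ} (p : Fin (n + 1) → V) :
    conePath p (Fin.last (n + 1)) = none := by
  simp [conePath]

lemma conePath_castSucc {V : Type} {n : ℕ} (p : Fin (n + 1) → V) (i : Fin (n + 1)) :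
    conePath p i.castSucc = some (p i) := by
  simp [conePath]

lemma conePath_injective {V : Type} {n : ℕ} :
    Function.Injective (conePath : (Fin (n + 1) → V) → _) := by
  intro p q h
  funext i
  have := congrFun h i.castSucc
  simpa [conePath_castSucc] using this

lemma conePath_face {V : Type} {n : ℕ} (p : Fin (n + 1 + 1) → V) (m : Fin (n + 1)) :
    (fun i : Fin (n + 2) => conePath p (m.succ.castSucc.succAbove i)) =
      conePath (fun i : Fin (n + 1) => p (m.succ.succAbove i)) := by
  funext i
  induction i using Fin.lastCases with
  | last =>
    rw [show m.succ.castSucc.succAbove (Fin.last (n + 1)) = Fin.last (n + 1 + 1) from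
      Fin.succAbove_ne_last_last (Fin.castSucc_ne_last _), conePath_last, conePath_last]
  | cast i =>
    rw [Fin.castSucc_succAbove_castSucc, conePath_castSucc, conePath_castSucc]

/-- The shifting chain map. -/
def coneMap (R V : Type) [CommRing R] (n : ℕ) :
    Chain R V n →ₗ[R] Chain R (Option V) (n + 1) :=
  Finsupp.lmapDomain R R conePath

lemma coneMap_single (R V : Type) [CommRing R] (n : ℕ) (p : Fin (n + 1) → V) (r : R) :
    coneMap R V n (Finsupp.single p r) = Finsupp.single (conePath p) r := by
  simp [coneMap, Finsupp.mapDomain_single]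

lemma coneMap_injective (R V : Type) [CommRing R] (n : ℕ) :
    Function.Injective (coneMap R V n) :=
  Finsupp.mapDomain_injective conePath_injective

lemma coneMap_boundary (R V : Type) [CommRing R] [DecidableEq V] (n : ℕ)
    (w : Chain R V (n + 1)) :
    clusterBoundary R (Option V) n (coneMap R V (n + 1) w) =
      coneMap R V n (tailBoundary R V n w) := by
  induction w using Finsupp.induction_linear with
  | zero => simp
  | add x y hx hy => simp only [map_add, hx, hy]
  | single p r =>
    rw [coneMap_single]
    simp only [clusterBoundary, tailBoundary, Finsupp.lsum_single, LinearMap.sum_apply,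
      LinearMap.smul_apply, Finsupp.lsingle_apply, map_sum, map_smul, coneMap_single,
      conePath_face]

lemma pathsWith_eq_supported (R V : Type) [CommRing R] [DecidableEq V] {n : ℕ}
    (P : (Fin (n + 1) → V) → Prop) :
    pathsWith R V P = Finsupp.supported R R {p | P p} := by
  ext w
  rw [Finsupp.mem_supported]
  exact Iff.rfl

lemma cone_allowed_iff {V : Type} (G : SDigraph V) (v : V) {n : ℕ}
    (q : Fin (n + 1 + 1) → Option V) :
    (IsAllowed (coneD G) q ∧ q 0 = some v ∧ q (Fin.last (n + 1)) = none) ↔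
      ∃ p : Fin (n + 1) → V, (IsAllowed G p ∧ p 0 = v) ∧ conePath p = q := by
  constructor
  · rintro ⟨ha, h0, hl⟩
    have hs : ∀ i : Fin (n + 1), ∃ x, q i.castSucc = some x := by
      intro i
      have := ha i
      rcases hq : q i.castSucc with _ | x
      · rw [hq] at this
        exact absurd this (by simp [coneD])
      · exact ⟨x, rfl⟩
    choose p hp using hs
    refine ⟨p, ⟨?_, ?_⟩, ?_⟩
    · intro i
      have := ha i.castSucc
      rw [← Fin.castSucc_succ, hp, hp] at this
      exact this
    · have := hp 0
      rw [Fin.castSucc_zero, h0] at this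
      exact (Option.some.inj this).symm
    · funext i
      induction i using Fin.lastCases with
      | last => rw [conePath_last, hl]
      | cast i => rw [conePath_castSucc, hp]
  · rintro ⟨p, ⟨ha, h0⟩, rfl⟩
    refine ⟨?_, ?_, conePath_last p⟩
    · intro i
      induction i using Fin.lastCases with
      | last =>
        rw [conePath_castSucc, Fin.succ_last, conePath_last]
        trivial
      | cast i =>
        rw [conePath_castSucc, ← Fin.castSucc_succ, conePath_castSucc]
        exact ha i
    · rw [← Fin.castSucc_zero, conePath_castSucc, h0]

lemma allowedCluster_cone (R V : Type) [CommRing R] [DecidableEq V] (G : SDigraph V) (v : V)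
    (n : ℕ) : allowedCluster R (Option V) (coneD G) (some v) none (n + 1) =
      (allowedTail R V G v n).map (coneMap R V n) := by
  simp only [allowedCluster, allowedTail, allowedChains, clusterSet, tailSet,
    pathsWith_eq_supported, ← Finsupp.supported_inter, coneMap]
  rw [Finsupp.lmapDomain_supported]
  congr 1
  ext q
  exact cone_allowed_iff G v q

lemma map_inf_comap_of_comm {R M N M' N' : Type} [CommRing R] [AddCommGroup M] [AddCommGroup N]
    [AddCommGroup M'] [AddCommGroup N'] [Module R M] [Module R N] [Module R M'] [Module R N']
    (f : M →ₗ[R] M') (g : N →ₗ[R] N') (hg : Function.Injective g)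
    (d : M →ₗ[R] N) (d' : M' →ₗ[R] N') (h : ∀ w, d' (f w) = g (d w))
    (A : Submodule R M) (B : Submodule R N) :
    (A.map f) ⊓ (B.map g).comap d' = (A ⊓ B.comap d).map f := by
  ext x
  constructor
  · rintro ⟨⟨a, ha, rfl⟩, b, hb, hbe⟩
    refine ⟨a, ⟨ha, ?_⟩, rfl⟩
    rw [h] at hbe
    have := hg hbe
    subst this
    exact hb
  · rintro ⟨a, ⟨ha, hb⟩, rfl⟩
    exact ⟨⟨a, ha, rfl⟩, d a, hb, (h a).symm⟩

lemma thetaChains_cone (R V : Type) [CommRing R] [DecidableEq V] (G : SDigraph V) (v : V)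
    (n : ℕ) : thetaChains R (Option V) (coneD G) (some v) none (n + 1) =
      (tailTheta R V G v n).map (coneMap R V n) := by
  cases n with
  | zero => exact allowedCluster_cone R V G v 0
  | succ n =>
    simp only [thetaChains, tailTheta]
    rw [allowedCluster_cone, allowedCluster_cone]
    exact map_inf_comap_of_comm _ _ (coneMap_injective R V n) _ _ (coneMap_boundary R V n) _ _

lemma thetaCycles_cone (R V : Type) [CommRing R] [DecidableEq V] (G : SDigraph V) (v : V)
    (n : ℕ) : thetaCycles R (Option V) (coneD G) (some v) none (n + 1) =
      (tailCycles R V G v n).map (coneMap R V n) := by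
  cases n with
  | zero => exact thetaChains_cone R V G v 0
  | succ n =>
    simp only [thetaCycles, tailCycles]
    rw [thetaChains_cone]
    have := map_inf_comap_of_comm (coneMap R V (n + 1)) _ (coneMap_injective R V n) _ _
      (coneMap_boundary R V n) (tailTheta R V G v (n + 1)) ⊥
    rwa [Submodule.map_bot] at this

lemma thetaBoundaries_cone (R V : Type) [CommRing R] [DecidableEq V] (G : SDigraph V) (v : V)
    (n : ℕ) : thetaBoundaries R (Option V) (coneD G) (some v) none (n + 1) =
      (tailBoundaries R V G v n).map (coneMap R V n) := by
  simp only [thetaBoundaries, tailBoundaries]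
  rw [thetaChains_cone, ← Submodule.map_comp, ← Submodule.map_comp]
  congr 1
  exact LinearMap.ext (coneMap_boundary R V n)

lemma subquotient_equiv {R M N : Type} [CommRing R] [AddCommGroup M] [AddCommGroup N]
    [Module R M] [Module R N] (f : M →ₗ[R] N) (hf : Function.Injective f)
    (Z B : Submodule R M) :
    Nonempty (↥((Z.map f).map (B.map f).mkQ) ≃ₗ[R] ↥(Z.map B.mkQ)) := by
  have hle : B ≤ (B.map f).comap f := Submodule.le_comap_map f B
  have hinj : Function.Injective (B.mapQ (B.map f) f hle) := by
    rw [← LinearMap.ker_eq_bot, Submodule.ker_mapQ, Submodule.comap_map_eq_of_injective hf,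
      Submodule.mkQ_map_self]
  have he : (Z.map f).map (B.map f).mkQ = (Z.map B.mkQ).map (B.mapQ (B.map f) f hle) := by
    rw [← Submodule.map_comp, ← Submodule.map_comp, Submodule.mapQ_mkQ]
  exact ⟨(LinearEquiv.ofEq _ _ he).trans (Submodule.equivMapOfInjective _ hinj _).symm⟩

end ConeProof

/-- Theorem 6.10: for the cone `CG` over `G` with apex `a`, the
primitive `(v,a)`-cluster homology of `CG` is the primitive `v`-tail homology of `G`
shifted by one: `H_n^{[v,a]}(CG) ≅ H_{n-1}^{[v,·]}(G)`. -/
theorem cone_cluster_homology_eq_tail_homology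
    (R : Type) [CommRing R] (V : Type) [DecidableEq V] [Fintype V]
    (G : SDigraph V) (v : V) (n : ℕ) :
    Nonempty (thetaHomology R (Option V) (coneD G) (some v) none (n + 1) ≃ₗ[R]
      tailHomology R V G v n) := by
  unfold thetaHomology tailHomology
  rw [thetaCycles_cone, thetaBoundaries_cone]
  exact subquotient_equiv _ (coneMap_injective R V n) _ _

end PrimitivePath

end
end
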